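/- arXiv:1604.05104 — 7 statements merged into one kernel-verified Lean document; each statement's English description precedes it below -/
import Mathlib

section
/- Let τ₀ ∈ ℝ and (x,t) ∈ ℝ². If the function τ ↦ γ(τ; x, t) is continuous at τ₀ (equivalently, ξ does not jump at τ₀ + ξ*(x) − t), then lim_{N→∞} γ^{(N)}(τ₀; x, t) = γ(τ₀; x, t). -/
open Filter Topology MeasureTheory Set

/-- Generalized inverse: `geninv f x = inf {t : f t ≥ x}`. -/
noncomputable def geninv (f : ℝ → ℝ) (x : ℝ) : ℝ := sInf {t : ℝ | x ≤ f t}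

/-- Piecewise affine interpolation of `ξ` through the dyadic grid points
`(k/2^N, ξ(k/2^N))`, `k ∈ ℤ`: for `s ∈ [(k-1)/2^N, k/2^N]`,
`ξ^{(N)}(s) = α ξ((k-1)/2^N) + (1-α) ξ(k/2^N)` with `α = (k/2^N - s)·2^N`. -/
noncomputable def dyadicInterp (ξ : ℝ → ℝ) (N : ℕ) (s : ℝ) : ℝ :=
  (((⌈s * 2 ^ N⌉ : ℤ) : ℝ) / 2 ^ N - s) * 2 ^ N
      * ξ ((((⌈s * 2 ^ N⌉ : ℤ) : ℝ) - 1) / 2 ^ N)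
    + (1 - (((⌈s * 2 ^ N⌉ : ℤ) : ℝ) / 2 ^ N - s) * 2 ^ N)
      * ξ (((⌈s * 2 ^ N⌉ : ℤ) : ℝ) / 2 ^ N)

/-- The dyadic interpolation of a monotone function is sandwiched between its translates
by one mesh width. -/
lemma dyadicInterp_mem_Icc {ξ : ℝ → ℝ} (hmono : Monotone ξ) (N : ℕ) (s : ℝ) :
    dyadicInterp ξ N s ∈ Icc (ξ (s - (1 / 2) ^ N)) (ξ (s + (1 / 2) ^ N)) := by
  unfold dyadicInterp
  have hp : (0 : ℝ) < 2 ^ N := by positivity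
  have hle := Int.le_ceil (s * 2 ^ N)
  have hlt := Int.ceil_lt_add_one (s * 2 ^ N)
  generalize ((⌈s * 2 ^ N⌉ : ℤ) : ℝ) = k at hle hlt ⊢
  have hα : (k / 2 ^ N - s) * 2 ^ N = k - s * 2 ^ N := by field_simp
  have hh : ((1 : ℝ) / 2) ^ N = 1 / 2 ^ N := by rw [div_pow, one_pow]
  have hlow : s - 1 / 2 ^ N ≤ (k - 1) / 2 ^ N := by
    rw [le_div_iff₀ hp, sub_mul, one_div, inv_mul_cancel₀ hp.ne']
    linarith
  have hupp : k / 2 ^ N ≤ s + 1 / 2 ^ N := by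
    rw [div_le_iff₀ hp, add_mul, one_div, inv_mul_cancel₀ hp.ne']
    linarith
  have hgrid : ξ ((k - 1) / 2 ^ N) ≤ ξ (k / 2 ^ N) := hmono (by gcongr; linarith)
  rw [hα, hh]
  have h1 := hmono hlow
  have h2 := hmono hupp
  constructor <;> nlinarith

/-- If `g` is sandwiched between the translates of a monotone `f` by `h`, the generalized
inverses of `f` and `g` differ by at most `h`. -/
lemma abs_geninv_sub_le {f g : ℝ → ℝ} {h x : ℝ} (hf : Monotone f)
    (htop : Tendsto f atTop atTop) (hbot : Tendsto f atBot atBot)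
    (hfg : ∀ s, g s ∈ Icc (f (s - h)) (f (s + h))) :
    |geninv g x - geninv f x| ≤ h := by
  have hne : {t : ℝ | x ≤ f t}.Nonempty := (htop.eventually_ge_atTop x).exists
  have hbdd : BddBelow {t : ℝ | x ≤ f t} := by
    obtain ⟨a, ha⟩ := (hbot.eventually_lt_atBot x).exists
    exact ⟨a, fun t ht => le_of_not_gt fun hta => (ha.trans_le (ht.trans (hf hta.le))).false⟩
  have hlb : geninv f x - h ∈ lowerBounds {t : ℝ | x ≤ g t} := fun t ht =>
    sub_le_iff_le_add.2 (csInf_le hbdd (le_trans ht (hfg t).2))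
  have hmem : ∀ t, geninv f x + h < t → t ∈ {t : ℝ | x ≤ g t} := by
    intro t ht
    obtain ⟨r, hr, hrt⟩ := exists_lt_of_csInf_lt hne (lt_sub_iff_add_lt.2 ht)
    exact le_trans hr ((hf hrt.le).trans (hfg t).1)
  have hlow : geninv f x - h ≤ geninv g x :=
    le_csInf ⟨_, hmem _ (lt_add_one _)⟩ hlb
  have hupp : geninv g x ≤ geninv f x + h :=
    le_of_forall_gt_imp_ge_of_dense fun t ht => csInf_le ⟨_, hlb⟩ (hmem t ht)
  rw [abs_le]
  constructor <;> linarith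

/-- if `τ ↦ γ(τ; x, t) = ξ(τ + ξ*(x) - t)` does not jump at `τ₀`, then
`γ^{(N)}(τ₀; x, t) = ξ^{(N)}(τ₀ + (ξ^{(N)})⁻¹(x) - t) → γ(τ₀; x, t)` as `N → ∞`. -/
theorem stmt0 (ξ : ℝ → ℝ) (hmono : StrictMono ξ)
    (hrc : ∀ s : ℝ, ContinuousWithinAt ξ (Set.Ici s) s)
    (hll : ∀ s : ℝ, ∃ L : ℝ, Tendsto ξ (𝓝[<] s) (𝓝 L))
    (htop : Tendsto ξ atTop atTop) (hbot : Tendsto ξ atBot atBot)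
    (x t τ₀ : ℝ)
    (hcont : ContinuousAt ξ (τ₀ + geninv ξ x - t)) :
    Tendsto (fun N : ℕ => dyadicInterp ξ N (τ₀ + geninv (dyadicInterp ξ N) x - t))
      atTop (𝓝 (ξ (τ₀ + geninv ξ x - t))) := by
  have hmesh : Tendsto (fun N : ℕ => ((1 : ℝ) / 2) ^ N) atTop (𝓝 0) :=
    tendsto_pow_atTop_nhds_zero_of_lt_one (by norm_num) (by norm_num)
  have hinv : Tendsto (fun N : ℕ => geninv (dyadicInterp ξ N) x) atTop (𝓝 (geninv ξ x)) :=
    tendsto_iff_norm_sub_tendsto_zero.2 <| squeeze_zero (fun _ => norm_nonneg _)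
      (fun N => abs_geninv_sub_le hmono.monotone htop hbot
        (dyadicInterp_mem_Icc hmono.monotone N)) hmesh
  have hs := (hinv.const_add τ₀).sub_const t
  have hlow := hs.sub hmesh
  have hupp := hs.add hmesh
  rw [sub_zero] at hlow
  rw [add_zero] at hupp
  exact tendsto_of_tendsto_of_tendsto_of_le_of_le (hcont.tendsto.comp hlow)
    (hcont.tendsto.comp hupp)
    (fun N => (dyadicInterp_mem_Icc hmono.monotone N _).1)
    (fun N => (dyadicInterp_mem_Icc hmono.monotone N _).2)
end

section
/- For every x ∈ ℝ and N ∈ ℕ there exists k ∈ ℤ such that both ξ*(x) and (ξ^{(N)})^{-1}(x) lie in the interval [(k−1)/2^N, k/2^N]; in particular |(ξ^{(N)})^{-1}(x) − ξ*(x)| ≤ 2^{-N}. -/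
open Filter Topology MeasureTheory Set

theorem geninv_mem_Icc {f : ℝ → ℝ} {x a b : ℝ} (hlt : ∀ t ≤ a, f t < x) (hle : x ≤ f b) :
    geninv f x ∈ Set.Icc a b := by
  have hlb : ∀ t ∈ {t : ℝ | x ≤ f t}, a ≤ t := by
    intro t ht
    by_contra! h
    exact absurd (hlt t h.le) (not_lt.mpr ht)
  exact ⟨le_csInf ⟨b, hle⟩ hlb, csInf_le ⟨a, hlb⟩ hle⟩

theorem dyadicInterp_grid (ξ : ℝ → ℝ) (N : ℕ) (k : ℤ) :
    dyadicInterp ξ N ((k : ℝ) / 2 ^ N) = ξ ((k : ℝ) / 2 ^ N) := by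
  have h : (k : ℝ) / 2 ^ N * 2 ^ N = k := div_mul_cancel₀ _ (by positivity)
  simp [dyadicInterp, h]

theorem dyadicInterp_le_of_le_grid {ξ : ℝ → ℝ} (hmono : Monotone ξ) (N : ℕ) {s : ℝ} {m : ℤ}
    (hs : s ≤ (m : ℝ) / 2 ^ N) : dyadicInterp ξ N s ≤ ξ ((m : ℝ) / 2 ^ N) := by
  have hp : (0 : ℝ) < 2 ^ N := by positivity
  have hceil : ⌈s * 2 ^ N⌉ ≤ m := Int.ceil_le.mpr ((le_div_iff₀ hp).mp hs)
  have hceil' : ((⌈s * 2 ^ N⌉ : ℤ) : ℝ) ≤ m := by exact_mod_cast hceil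
  have h1 := Int.le_ceil (s * 2 ^ N)
  have h2 := Int.ceil_lt_add_one (s * 2 ^ N)
  unfold dyadicInterp
  set c : ℝ := ((⌈s * 2 ^ N⌉ : ℤ) : ℝ)
  have hα : (c / 2 ^ N - s) * 2 ^ N = c - s * 2 ^ N := by field_simp
  have hξ₁ : ξ ((c - 1) / 2 ^ N) ≤ ξ ((m : ℝ) / 2 ^ N) := hmono (by gcongr; linarith)
  have hξ₂ : ξ (c / 2 ^ N) ≤ ξ ((m : ℝ) / 2 ^ N) := hmono (by gcongr)
  rw [hα]
  nlinarith [mul_le_mul_of_nonneg_left hξ₁ (by linarith : 0 ≤ c - s * 2 ^ N),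
    mul_le_mul_of_nonneg_left hξ₂ (by linarith : 0 ≤ 1 - (c - s * 2 ^ N))]

theorem exists_grid_lt_le {ξ : ℝ → ℝ} (hmono : Monotone ξ)
    (htop : Tendsto ξ atTop atTop) (hbot : Tendsto ξ atBot atBot) (x : ℝ) (N : ℕ) :
    ∃ k : ℤ, ξ (((k : ℝ) - 1) / 2 ^ N) < x ∧ x ≤ ξ ((k : ℝ) / 2 ^ N) := by
  have hp : (0 : ℝ) < 2 ^ N := by positivity
  obtain ⟨b, hb⟩ := (htop.eventually_ge_atTop x).exists
  obtain ⟨a, ha⟩ := (hbot.eventually_lt_atBot x).exists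
  obtain ⟨k, hk, hmin⟩ := Int.exists_least_of_bdd (P := fun k : ℤ => x ≤ ξ ((k : ℝ) / 2 ^ N))
    ⟨⌊a * 2 ^ N⌋, fun z hz => by
      by_contra! h
      have hz' : (z : ℝ) / 2 ^ N ≤ a :=
        (div_le_iff₀ hp).mpr (Int.le_floor.mp h.le)
      linarith [hmono hz']⟩
    ⟨⌈b * 2 ^ N⌉, hb.trans (hmono ((le_div_iff₀ hp).mpr (Int.le_ceil _)))⟩
  refine ⟨k, ?_, hk⟩
  by_contra! h
  have := hmin (k - 1) (by push_cast; exact h)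
  omega

/-- for every `x` and `N` there is `k ∈ ℤ` with both `ξ*(x)` and
`(ξ^{(N)})⁻¹(x)` in `[(k-1)/2^N, k/2^N]`; in particular
`|(ξ^{(N)})⁻¹(x) - ξ*(x)| ≤ 2^{-N}`. -/
theorem stmt3 (ξ : ℝ → ℝ) (hmono : StrictMono ξ)
    (hrc : ∀ s : ℝ, ContinuousWithinAt ξ (Set.Ici s) s)
    (hll : ∀ s : ℝ, ∃ L : ℝ, Tendsto ξ (𝓝[<] s) (𝓝 L))
    (htop : Tendsto ξ atTop atTop) (hbot : Tendsto ξ atBot atBot)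
    (x : ℝ) (N : ℕ) :
    (∃ k : ℤ,
        geninv ξ x ∈ Set.Icc (((k : ℝ) - 1) / 2 ^ N) ((k : ℝ) / 2 ^ N) ∧
        geninv (dyadicInterp ξ N) x ∈ Set.Icc (((k : ℝ) - 1) / 2 ^ N) ((k : ℝ) / 2 ^ N)) ∧
      |geninv (dyadicInterp ξ N) x - geninv ξ x| ≤ 1 / 2 ^ N := by
  obtain ⟨k, hlt, hle⟩ := exists_grid_lt_le hmono.monotone htop hbot x N
  have h₁ : geninv ξ x ∈ Set.Icc (((k : ℝ) - 1) / 2 ^ N) ((k : ℝ) / 2 ^ N) :=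
    geninv_mem_Icc (fun t ht => (hmono.monotone ht).trans_lt hlt) hle
  have h₂ : geninv (dyadicInterp ξ N) x ∈ Set.Icc (((k : ℝ) - 1) / 2 ^ N) ((k : ℝ) / 2 ^ N) := by
    refine geninv_mem_Icc (fun t ht => ?_) (hle.trans_eq (dyadicInterp_grid ξ N k).symm)
    have := dyadicInterp_le_of_le_grid hmono.monotone N (s := t) (m := k - 1)
      (by push_cast; exact ht)
    push_cast at this
    exact this.trans_lt hlt
  refine ⟨⟨k, h₁, h₂⟩, (abs_sub_le_of_le_of_le h₂.1 h₂.2 h₁.1 h₁.2).trans_eq ?_⟩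
  ring
end

section
/- For Lebesgue-almost every (x,t) ∈ ℝ² one has lim_{N→∞} γ^{(N)}(0; x, t) = γ(0; x, t). -/
open Filter Topology MeasureTheory Set

/-- The interpolation error is controlled by shifting the argument by one grid step. -/
theorem dyadicInterp_bounds {ξ : ℝ → ℝ} (hξ : Monotone ξ) (N : ℕ) (s : ℝ) :
    ξ (s - (2 ^ N)⁻¹) ≤ dyadicInterp ξ N s ∧ dyadicInterp ξ N s ≤ ξ (s + (2 ^ N)⁻¹) := by
  have hp : (0 : ℝ) < 2 ^ N := by positivity
  unfold dyadicInterp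
  have h1 := Int.le_ceil (s * 2 ^ N)
  have h2 := Int.ceil_lt_add_one (s * 2 ^ N)
  generalize ((⌈s * 2 ^ N⌉ : ℤ) : ℝ) = k at h1 h2
  have hα : (k / 2 ^ N - s) * 2 ^ N = k - s * 2 ^ N := by field_simp
  have hlow : ξ (s - (2 ^ N)⁻¹) ≤ ξ ((k - 1) / 2 ^ N) := hξ <| by
    rw [le_div_iff₀ hp, sub_mul, inv_mul_cancel₀ hp.ne']
    linarith
  have hmid : ξ ((k - 1) / 2 ^ N) ≤ ξ (k / 2 ^ N) := hξ <| by
    gcongr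
    linarith
  have hhigh : ξ (k / 2 ^ N) ≤ ξ (s + (2 ^ N)⁻¹) := hξ <| by
    rw [div_le_iff₀ hp, add_mul, inv_mul_cancel₀ hp.ne']
    linarith
  rw [hα]
  constructor <;> nlinarith

theorem bddBelow_le_of_tendsto_atBot {f : ℝ → ℝ} (hf : Monotone f)
    (hbot : Tendsto f atBot atBot) (x : ℝ) : BddBelow {t | x ≤ f t} := by
  obtain ⟨a, ha⟩ := (hbot.eventually_lt_atBot x).exists
  exact ⟨a, fun t ht => le_of_not_gt fun h => absurd (hf h.le) (not_le.2 (ha.trans_le ht))⟩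

theorem nonempty_le_of_tendsto_atTop {f : ℝ → ℝ} (htop : Tendsto f atTop atTop) (x : ℝ) :
    {t | x ≤ f t}.Nonempty :=
  (htop.eventually_ge_atTop x).exists

theorem monotone_geninv {f : ℝ → ℝ} (hf : Monotone f) (htop : Tendsto f atTop atTop)
    (hbot : Tendsto f atBot atBot) : Monotone (geninv f) := fun x y hxy =>
  csInf_le_csInf (bddBelow_le_of_tendsto_atBot hf hbot x) (nonempty_le_of_tendsto_atTop htop y)
    fun _ ht => hxy.trans ht

/-- If `g ≤ f (· + δ)` then the generalized inverse of `g` is at least that of `f`, up to `δ`. -/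
theorem geninv_le_geninv_add {f g : ℝ → ℝ} {δ x : ℝ} (hf : BddBelow {t | x ≤ f t})
    (hg : {t | x ≤ g t}.Nonempty) (h : ∀ s, g s ≤ f (s + δ)) :
    geninv f x ≤ geninv g x + δ := by
  rw [← sub_le_iff_le_add]
  refine le_csInf hg fun t ht => ?_
  rw [sub_le_iff_le_add]
  exact csInf_le hf (ht.trans (h t))

theorem tendsto_geninv_dyadicInterp {ξ : ℝ → ℝ} (hξ : Monotone ξ)
    (htop : Tendsto ξ atTop atTop) (hbot : Tendsto ξ atBot atBot) (x : ℝ) :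
    Tendsto (fun N : ℕ => geninv (dyadicInterp ξ N) x) atTop (𝓝 (geninv ξ x)) := by
  have hδ : Tendsto (fun N : ℕ => ((2 : ℝ) ^ N)⁻¹) atTop (𝓝 0) :=
    tendsto_inv_atTop_zero.comp (tendsto_pow_atTop_atTop_of_one_lt one_lt_two)
  have hb := bddBelow_le_of_tendsto_atBot hξ hbot x
  have hne := nonempty_le_of_tendsto_atTop htop x
  have hshift (N : ℕ) (s : ℝ) : ξ s ≤ dyadicInterp ξ N (s + (2 ^ N)⁻¹) := by
    have h := (dyadicInterp_bounds hξ N (s + (2 ^ N)⁻¹)).1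
    rwa [add_sub_cancel_right] at h
  have hneN (N : ℕ) : {t | x ≤ dyadicInterp ξ N t}.Nonempty :=
    hne.elim fun t ht => ⟨t + (2 ^ N)⁻¹, le_trans ht (hshift N t)⟩
  have hbN (N : ℕ) : BddBelow {t | x ≤ dyadicInterp ξ N t} := by
    obtain ⟨a, ha⟩ := hb
    exact ⟨a - (2 ^ N)⁻¹, fun t ht =>
      sub_le_iff_le_add.2 (ha (le_trans ht (dyadicInterp_bounds hξ N t).2))⟩
  refine tendsto_of_tendsto_of_tendsto_of_le_of_le
    (g := fun N : ℕ => geninv ξ x - (2 ^ N)⁻¹) (h := fun N : ℕ => geninv ξ x + (2 ^ N)⁻¹)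
    (by simpa using tendsto_const_nhds.sub hδ) (by simpa using tendsto_const_nhds.add hδ)
    (fun N => sub_le_iff_le_add.2 ?_) (fun N => ?_)
  · exact geninv_le_geninv_add hb (hneN N) fun s => (dyadicInterp_bounds hξ N s).2
  · exact geninv_le_geninv_add (hbN N) hne (hshift N)

/-- At a continuity point of `ξ`, the interpolations converge along every convergent sequence. -/
theorem tendsto_dyadicInterp_of_continuousAt {ξ : ℝ → ℝ} (hξ : Monotone ξ) {u : ℝ}
    (hu : ContinuousAt ξ u) {v : ℕ → ℝ} (hv : Tendsto v atTop (𝓝 u)) :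
    Tendsto (fun N => dyadicInterp ξ N (v N)) atTop (𝓝 (ξ u)) := by
  have hδ : Tendsto (fun N : ℕ => ((2 : ℝ) ^ N)⁻¹) atTop (𝓝 0) :=
    tendsto_inv_atTop_zero.comp (tendsto_pow_atTop_atTop_of_one_lt one_lt_two)
  exact tendsto_of_tendsto_of_tendsto_of_le_of_le
    (hu.tendsto.comp (by simpa using hv.sub hδ)) (hu.tendsto.comp (by simpa using hv.add hδ))
    (fun N => (dyadicInterp_bounds hξ N (v N)).1) (fun N => (dyadicInterp_bounds hξ N (v N)).2)

/-- A shear-type map `(x, t) ↦ f x - t` almost surely avoids any given countable set. -/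
theorem ae_sub_notMem_of_countable {f : ℝ → ℝ} (hf : Measurable f) {D : Set ℝ}
    (hD : D.Countable) : ∀ᵐ p : ℝ × ℝ, f p.1 - p.2 ∉ D := by
  have hmeas : MeasurableSet {p : ℝ × ℝ | f p.1 - p.2 ∉ D} :=
    ((hf.comp measurable_fst).sub measurable_snd) hD.measurableSet.compl
  rw [Measure.volume_eq_prod, Measure.ae_prod_iff_ae_ae hmeas]
  refine Eventually.of_forall fun x => ?_
  have hc : ((fun t => f x - t) ⁻¹' D).Countable := hD.preimage sub_right_injective
  exact hc.ae_notMem volume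

/-- for Lebesgue-almost every `(x,t) ∈ ℝ²`,
`γ^{(N)}(0; x, t) = ξ^{(N)}(0 + (ξ^{(N)})⁻¹(x) - t)` converges to
`γ(0; x, t) = ξ(0 + ξ*(x) - t)` as `N → ∞`. -/
theorem stmt5 (ξ : ℝ → ℝ) (hmono : StrictMono ξ)
    (hrc : ∀ s : ℝ, ContinuousWithinAt ξ (Set.Ici s) s)
    (hll : ∀ s : ℝ, ∃ L : ℝ, Tendsto ξ (𝓝[<] s) (𝓝 L))
    (htop : Tendsto ξ atTop atTop) (hbot : Tendsto ξ atBot atBot) :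
    ∀ᵐ p : ℝ × ℝ ∂(volume : Measure (ℝ × ℝ)),
      Tendsto (fun N : ℕ => dyadicInterp ξ N (0 + geninv (dyadicInterp ξ N) p.1 - p.2))
        atTop (𝓝 (ξ (0 + geninv ξ p.1 - p.2))) := by
  filter_upwards [ae_sub_notMem_of_countable
    (monotone_geninv hmono.monotone htop hbot).measurable
    hmono.monotone.countable_not_continuousAt] with p hp
  simp only [zero_add]
  exact tendsto_dyadicInterp_of_continuousAt hmono.monotone (not_not.1 hp)
    ((tendsto_geninv_dyadicInterp hmono.monotone htop hbot p.1).sub_const p.2)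
end

section
/- Let u₀ : ℝ → ℝ be bounded and continuous, let 1 ≤ p < ∞ and let K ⊆ ℝ² be compact. Then ∫_K |u₀(γ^{(N)}(0; x, t)) − u₀(γ(0; x, t))|^p dλ(x,t) → 0 as N → ∞, where λ is two-dimensional Lebesgue measure. -/
open Filter Topology MeasureTheory Set

theorem dyadicInterp_le_of_monotone {ξ : ℝ → ℝ} (hξ : Monotone ξ) (N : ℕ) (s : ℝ) :
    dyadicInterp ξ N s ≤ ξ (s + 1 / 2 ^ N) ∧ ξ (s - 1 / 2 ^ N) ≤ dyadicInterp ξ N s := by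
  unfold dyadicInterp
  have hM : (0 : ℝ) < 2 ^ N := by positivity
  have h1 := Int.le_ceil (s * 2 ^ N)
  have h2 := Int.ceil_lt_add_one (s * 2 ^ N)
  generalize ((⌈s * 2 ^ N⌉ : ℤ) : ℝ) = k at *
  generalize (2 : ℝ) ^ N = M at *
  have ha : (k / M - s) * M = k - s * M := by field_simp
  rw [ha]
  have h3 : ξ ((k - 1) / M) ≤ ξ (s + 1 / M) := hξ <| by
    rw [div_le_iff₀ hM, add_mul, one_div_mul_cancel hM.ne']; linarith
  have h4 : ξ (k / M) ≤ ξ (s + 1 / M) := hξ <| by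
    rw [div_le_iff₀ hM, add_mul, one_div_mul_cancel hM.ne']; linarith
  have h5 : ξ (s - 1 / M) ≤ ξ ((k - 1) / M) := hξ <| by
    rw [le_div_iff₀ hM, sub_mul, one_div_mul_cancel hM.ne']; linarith
  have h6 : ξ (s - 1 / M) ≤ ξ (k / M) := hξ <| by
    rw [le_div_iff₀ hM, sub_mul, one_div_mul_cancel hM.ne']; linarith
  have ha0 : 0 ≤ k - s * M := by linarith
  have ha1 : 0 ≤ 1 - (k - s * M) := by linarith
  constructor <;> nlinarith

theorem measurable_dyadicInterp {ξ : ℝ → ℝ} (hξ : Measurable ξ) (N : ℕ) :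
    Measurable (dyadicInterp ξ N) := by
  have hk : Measurable fun s : ℝ => ((⌈s * 2 ^ N⌉ : ℤ) : ℝ) :=
    (measurable_from_top (f := fun k : ℤ => (k : ℝ))).comp
      (Int.measurable_ceil.comp (measurable_id.mul_const _))
  unfold dyadicInterp
  exact ((((hk.div_const _).sub measurable_id).mul_const _).mul
    (hξ.comp ((hk.sub_const _).div_const _))).add
    ((measurable_const.sub (((hk.div_const _).sub measurable_id).mul_const _)).mul
    (hξ.comp (hk.div_const _)))

theorem monotone_geninv_s6 {f : ℝ → ℝ} (hne : ∀ x, {t : ℝ | x ≤ f t}.Nonempty)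
    (hbdd : ∀ x, BddBelow {t : ℝ | x ≤ f t}) : Monotone (geninv f) :=
  fun x y hxy => csInf_le_csInf (hbdd x) (hne y) fun _ ht => hxy.trans ht

section Superlevel

variable {ξ : ℝ → ℝ}

theorem nonempty_superlevel (htop : Tendsto ξ atTop atTop) (x : ℝ) :
    {t : ℝ | x ≤ ξ t}.Nonempty :=
  (htop.eventually_ge_atTop x).exists

theorem bddBelow_superlevel (hmono : Monotone ξ) (hbot : Tendsto ξ atBot atBot) (x : ℝ) :
    BddBelow {t : ℝ | x ≤ ξ t} := by
  obtain ⟨b, hb⟩ := (hbot.eventually_lt_atBot x).exists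
  refine ⟨b, fun t ht => ?_⟩
  by_contra! h
  exact absurd (ht.trans (hmono h.le)) hb.not_ge

theorem nonempty_superlevel_dyadicInterp (hmono : Monotone ξ) (htop : Tendsto ξ atTop atTop)
    (N : ℕ) (x : ℝ) : {t : ℝ | x ≤ dyadicInterp ξ N t}.Nonempty := by
  obtain ⟨t, ht⟩ := nonempty_superlevel htop x
  refine ⟨t + 1 / 2 ^ N, (show x ≤ ξ t from ht).trans ?_⟩
  simpa using (dyadicInterp_le_of_monotone hmono N (t + 1 / 2 ^ N)).2

theorem geninv_sub_le_of_le_dyadicInterp (hmono : Monotone ξ) (hbot : Tendsto ξ atBot atBot)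
    {N : ℕ} {x t : ℝ} (ht : x ≤ dyadicInterp ξ N t) : geninv ξ x - 1 / 2 ^ N ≤ t :=
  sub_le_iff_le_add.2 <| csInf_le (bddBelow_superlevel hmono hbot x)
    (ht.trans (dyadicInterp_le_of_monotone hmono N t).1)

theorem bddBelow_superlevel_dyadicInterp (hmono : Monotone ξ) (hbot : Tendsto ξ atBot atBot)
    (N : ℕ) (x : ℝ) : BddBelow {t : ℝ | x ≤ dyadicInterp ξ N t} :=
  ⟨_, fun _ ht => geninv_sub_le_of_le_dyadicInterp hmono hbot ht⟩

theorem abs_geninv_dyadicInterp_sub_le (hmono : Monotone ξ)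
    (htop : Tendsto ξ atTop atTop) (hbot : Tendsto ξ atBot atBot) (N : ℕ) (x : ℝ) :
    |geninv (dyadicInterp ξ N) x - geninv ξ x| ≤ 1 / 2 ^ N := by
  have hlow : geninv ξ x - 1 / 2 ^ N ≤ geninv (dyadicInterp ξ N) x :=
    le_csInf (nonempty_superlevel_dyadicInterp hmono htop N x)
      fun _ ht => geninv_sub_le_of_le_dyadicInterp hmono hbot ht
  have hup : geninv (dyadicInterp ξ N) x - 1 / 2 ^ N ≤ geninv ξ x := by
    refine le_csInf (nonempty_superlevel htop x) fun t ht => sub_le_iff_le_add.2 ?_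
    refine csInf_le (bddBelow_superlevel_dyadicInterp hmono hbot N x)
      ((show x ≤ ξ t from ht).trans ?_)
    simpa using (dyadicInterp_le_of_monotone hmono N (t + 1 / 2 ^ N)).2
  rw [abs_le]
  constructor <;> linarith

end Superlevel

theorem tendsto_one_div_two_pow : Tendsto (fun N : ℕ => (1 : ℝ) / 2 ^ N) atTop (𝓝 0) := by
  simpa using tendsto_pow_atTop_nhds_zero_of_lt_one (r := (1 / 2 : ℝ)) (by norm_num) (by norm_num)

theorem tendsto_dyadicInterp_of_continuousAt_s6 {ξ : ℝ → ℝ} (hmono : Monotone ξ) {s : ℕ → ℝ} {a : ℝ}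
    (hs : Tendsto s atTop (𝓝 a)) (ha : ContinuousAt ξ a) :
    Tendsto (fun N => dyadicInterp ξ N (s N)) atTop (𝓝 (ξ a)) := by
  have hlow : Tendsto (fun N => s N - 1 / 2 ^ N) atTop (𝓝 a) := by
    simpa using hs.sub tendsto_one_div_two_pow
  have hup : Tendsto (fun N => s N + 1 / 2 ^ N) atTop (𝓝 a) := by
    simpa using hs.add tendsto_one_div_two_pow
  exact tendsto_of_tendsto_of_tendsto_of_le_of_le (ha.tendsto.comp hlow) (ha.tendsto.comp hup)
    (fun N => (dyadicInterp_le_of_monotone hmono N (s N)).2)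
    fun N => (dyadicInterp_le_of_monotone hmono N (s N)).1

theorem ae_continuousAt_sub {ξ g : ℝ → ℝ} (hmono : Monotone ξ) (hg : Measurable g) :
    ∀ᵐ q : ℝ × ℝ, ContinuousAt ξ (g q.1 - q.2) := by
  have hD : {s | ¬ContinuousAt ξ s}.Countable := hmono.countable_not_continuousAt
  have hmeas : MeasurableSet {q : ℝ × ℝ | ContinuousAt ξ (g q.1 - q.2)} := by
    have := ((hg.comp measurable_fst).sub measurable_snd) hD.measurableSet.compl
    simpa [Set.preimage, Set.compl_def] using this
  rw [Measure.volume_eq_prod, Measure.ae_prod_iff_ae_ae hmeas]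
  refine ae_of_all _ fun x => ?_
  refine measure_mono_null (fun t ht => ?_) ((hD.image fun s => g x - s).measure_zero volume)
  exact ⟨g x - t, ht, by ring⟩

/-- for bounded continuous `u₀`, `1 ≤ p < ∞` and compact `K ⊆ ℝ²`,
`∫_K |u₀(γ^{(N)}(0;x,t)) - u₀(γ(0;x,t))|^p dλ(x,t) → 0` as `N → ∞`. -/
theorem stmt6 (ξ : ℝ → ℝ) (hmono : StrictMono ξ)
    (hrc : ∀ s : ℝ, ContinuousWithinAt ξ (Set.Ici s) s)
    (hll : ∀ s : ℝ, ∃ L : ℝ, Tendsto ξ (𝓝[<] s) (𝓝 L))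
    (htop : Tendsto ξ atTop atTop) (hbot : Tendsto ξ atBot atBot)
    (u₀ : ℝ → ℝ) (hu₀c : Continuous u₀) (hu₀b : ∃ C : ℝ, ∀ y : ℝ, |u₀ y| ≤ C)
    (p : ℝ) (hp : 1 ≤ p) (K : Set (ℝ × ℝ)) (hK : IsCompact K) :
    Tendsto
      (fun N : ℕ =>
        ∫ q in K,
          |u₀ (dyadicInterp ξ N (0 + geninv (dyadicInterp ξ N) q.1 - q.2))
              - u₀ (ξ (0 + geninv ξ q.1 - q.2))| ^ p
          ∂(volume : Measure (ℝ × ℝ)))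
      atTop (𝓝 0) := by
  obtain ⟨C, hC⟩ := hu₀b
  have hm := hmono.monotone
  have hp0 : 0 < p := by linarith
  have hg : Measurable (geninv ξ) :=
    (monotone_geninv_s6 (nonempty_superlevel htop) (bddBelow_superlevel hm hbot)).measurable
  have hgN (N : ℕ) : Measurable (geninv (dyadicInterp ξ N)) :=
    (monotone_geninv_s6 (nonempty_superlevel_dyadicInterp hm htop N)
      (bddBelow_superlevel_dyadicInterp hm hbot N)).measurable
  have : IsFiniteMeasure ((volume : Measure (ℝ × ℝ)).restrict K) :=
    isFiniteMeasure_restrict.2 hK.measure_lt_top.ne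
  simp only [zero_add]
  rw [← integral_zero (ℝ × ℝ) ℝ (μ := (volume : Measure (ℝ × ℝ)).restrict K)]
  refine tendsto_integral_of_dominated_convergence (fun _ => (C + C) ^ p) (fun N => ?_)
    (integrable_const _) (fun N => ae_of_all _ fun q => ?_) ?_
  · have hshift (g : ℝ → ℝ) (hg' : Measurable g) :
        Measurable fun q : ℝ × ℝ => g q.1 - q.2 :=
      (hg'.comp measurable_fst).sub measurable_snd
    have h1 := hu₀c.measurable.comp
      ((measurable_dyadicInterp hm.measurable N).comp (hshift _ (hgN N)))
    have h2 := hu₀c.measurable.comp (hm.measurable.comp (hshift _ hg))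
    exact (((h1.sub h2).norm).pow_const p).aestronglyMeasurable
  · rw [Real.norm_of_nonneg (by positivity)]
    exact Real.rpow_le_rpow (abs_nonneg _)
      ((abs_sub _ _).trans (add_le_add (hC _) (hC _))) hp0.le
  · refine ae_restrict_of_ae ?_
    filter_upwards [ae_continuousAt_sub hm hg] with q hq
    have hgq : Tendsto (fun N => geninv (dyadicInterp ξ N) q.1) atTop (𝓝 (geninv ξ q.1)) :=
      tendsto_iff_norm_sub_tendsto_zero.2 <| squeeze_zero (fun _ => norm_nonneg _)
        (fun N => abs_geninv_dyadicInterp_sub_le hm htop hbot N q.1) tendsto_one_div_two_pow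
    have hlim := (hu₀c.tendsto _).comp
      (tendsto_dyadicInterp_of_continuousAt_s6 hm (hgq.sub_const q.2) hq)
    have hzero := ((hlim.sub_const (u₀ (ξ (geninv ξ q.1 - q.2)))).abs).rpow_const
      (p := p) (Or.inr hp0.le)
    simpa [Real.zero_rpow hp0.ne'] using hzero
end

section
/- Let (Ω, 𝓕, P) be a probability space and X : Ω × ℝ → ℝ jointly measurable such that for P-almost every ω the path X(ω, ·) is strictly increasing, right-continuous with left limits, and tends to ±∞ as t → ±∞. Then the function d(ω, x, t) = X(ω, X*(ω,x) − t) − lim_{τ↑0} X(ω, X*(ω,x) − t + τ) is 𝓕 ⊗ 𝓑(ℝ²)-measurable, and consequently the set 𝓜 = {(ω, x, t) : τ ↦ Γ(ω; τ; x, t) has a jump at τ = 0} = d^{-1}(ℝ \ {0}) is measurable. -/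
open Filter Topology MeasureTheory Set

/-- The function `d(ω, x, t) = X(ω, X*(ω,x) - t) - lim_{τ↑0} X(ω, X*(ω,x) - t + τ)`,
where `X*(ω,x) = inf {t : X(ω,t) ≥ x}`, measuring the jump of
`τ ↦ Γ(ω; τ; x, t) = X(ω, τ + X*(ω,x) - t)` at `τ = 0`. -/
noncomputable def dFun {Ω : Type*} (X : Ω × ℝ → ℝ) (p : Ω × ℝ × ℝ) : ℝ :=
  X (p.1, sInf {t : ℝ | p.2.1 ≤ X (p.1, t)} - p.2.2)
    - Function.leftLim (fun r => X (p.1, r)) (sInf {t : ℝ | p.2.1 ≤ X (p.1, t)} - p.2.2)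

/-- For a monotone right-continuous function tending to `±∞`, the generalized inverse
`sInf {t | x ≤ f t}` and `f` form a Galois connection. -/
theorem sInf_setOf_le_le_iff {f : ℝ → ℝ} (hf : Monotone f)
    (hc : ∀ s, ContinuousWithinAt f (Ici s) s) (htop : Tendsto f atTop atTop)
    (hbot : Tendsto f atBot atBot) (x c : ℝ) :
    sInf {t : ℝ | x ≤ f t} ≤ c ↔ x ≤ f c := by
  have hbdd : BddBelow {t : ℝ | x ≤ f t} := by
    obtain ⟨b, hb⟩ := (hbot.eventually (eventually_lt_atBot x)).exists
    exact ⟨b, fun t ht => le_of_not_gt fun h => absurd (hf h.le) (not_le.2 (hb.trans_le ht))⟩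
  have hne : {t : ℝ | x ≤ f t}.Nonempty :=
    (htop.eventually (eventually_ge_atTop x)).exists
  refine ⟨fun h => ?_, fun h => csInf_le hbdd h⟩
  have hright : Tendsto f (𝓝[>] c) (𝓝 (f c)) :=
    (hc c).mono_left (nhdsWithin_mono c Ioi_subset_Ici_self)
  refine ge_of_tendsto hright ?_
  filter_upwards [self_mem_nhdsWithin] with t ht
  obtain ⟨u, hu, hut⟩ := exists_lt_of_csInf_lt hne (h.trans_lt ht)
  exact le_trans hu (hf hut.le)

/-- The left limit of a jointly measurable process with monotone paths is jointly measurable. -/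
theorem measurable_leftLim_of_monotone {α : Type*} [MeasurableSpace α] {Y : α × ℝ → ℝ}
    (hY : Measurable Y) (hmono : ∀ a, Monotone fun t => Y (a, t)) :
    Measurable fun q : α × ℝ => Function.leftLim (fun t => Y (q.1, t)) q.2 := by
  refine measurable_of_tendsto_metrizable (f := fun (n : ℕ) (q : α × ℝ) =>
    Y (q.1, q.2 - 1 / ((n : ℝ) + 1))) (fun n => by fun_prop) (tendsto_pi_nhds.2 fun q => ?_)
  refine ((hmono q.1).tendsto_leftLim q.2).comp
    (tendsto_nhdsWithin_iff.2 ⟨?_, Eventually.of_forall fun n => ?_⟩)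
  · simpa using (tendsto_const_nhds (x := q.2)).sub
      (tendsto_one_div_add_atTop_nhds_zero_nat (𝕜 := ℝ))
  · exact sub_lt_self q.2 (by positivity)

/-- let `Ω₀` be the P-full measurable set of `ω` whose paths are strictly
increasing, càdlàg and tend to `±∞`. Then `d : Ω₀ × ℝ² → ℝ` is measurable (with respect to
the trace of `𝓕` on `Ω₀` and the Borel σ-algebra of `ℝ²`), and consequently the set
`𝓜 = {(ω,x,t) : τ ↦ Γ(ω;τ;x,t) jumps at τ=0} = d⁻¹(ℝ \ {0})` is measurable. -/
theorem stmt9 {Ω : Type*} [MeasurableSpace Ω] (P : Measure Ω) [IsProbabilityMeasure P]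
    (X : Ω × ℝ → ℝ) (hX : Measurable X)
    (Ω₀ : Set Ω) (hΩ₀ : MeasurableSet Ω₀) (hPΩ₀ : P Ω₀ = 1)
    (hnice : ∀ ω ∈ Ω₀,
      StrictMono (fun t => X (ω, t)) ∧
      (∀ s : ℝ, ContinuousWithinAt (fun t => X (ω, t)) (Set.Ici s) s) ∧
      (∀ s : ℝ, ∃ L : ℝ, Tendsto (fun t => X (ω, t)) (𝓝[<] s) (𝓝 L)) ∧
      Tendsto (fun t => X (ω, t)) atTop atTop ∧
      Tendsto (fun t => X (ω, t)) atBot atBot) :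
    Measurable (fun p : ↥Ω₀ × ℝ × ℝ => dFun X ((p.1 : Ω), p.2)) ∧
      MeasurableSet {p : ↥Ω₀ × ℝ × ℝ | dFun X ((p.1 : Ω), p.2) ≠ 0} := by
  have hXΩ₀ : Measurable fun q : ↥Ω₀ × ℝ => X ((q.1 : Ω), q.2) := by fun_prop
  have hinv : Measurable fun p : ↥Ω₀ × ℝ × ℝ =>
      sInf {t : ℝ | p.2.1 ≤ X ((p.1 : Ω), t)} := by
    refine measurable_of_Iic fun c => ?_
    have hpre : (fun p : ↥Ω₀ × ℝ × ℝ => sInf {t : ℝ | p.2.1 ≤ X ((p.1 : Ω), t)}) ⁻¹' Iic c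
        = {p | p.2.1 ≤ X ((p.1 : Ω), c)} := by
      ext p
      obtain ⟨hmono, hright, -, htop, hbot⟩ := hnice p.1 p.1.2
      exact sInf_setOf_le_le_iff hmono.monotone hright htop hbot p.2.1 c
    rw [hpre]
    exact measurableSet_le (by fun_prop) (by fun_prop)
  have harg : Measurable fun p : ↥Ω₀ × ℝ × ℝ =>
      (p.1, sInf {t : ℝ | p.2.1 ≤ X ((p.1 : Ω), t)} - p.2.2) := by fun_prop
  have hd : Measurable fun p : ↥Ω₀ × ℝ × ℝ => dFun X ((p.1 : Ω), p.2) :=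
    (hXΩ₀.comp harg).sub ((measurable_leftLim_of_monotone hXΩ₀
      fun ω => (hnice ω ω.2).1.monotone).comp harg)
  exact ⟨hd, hd (measurableSet_singleton 0).compl⟩
end

section
/- Let Δt > 0, t_j = jΔt for j ∈ ℤ, and let (x_k)_{k∈ℤ} be a strictly increasing sequence of reals with x₀ = 0 and x_k → ±∞ as k → ±∞. Define the piecewise constant speed c(x) = Σ_{k∈ℤ} ((x_k − x_{k−1})/Δt) · 1_{[x_{k−1}, x_k)}(x), and let ξ : ℝ → ℝ be the continuous piecewise affine function with ξ(t_k) = x_k for all k ∈ ℤ and affine on each interval [t_{k−1}, t_k]. Then for every τ ∈ ℝ that is not of the form t_j, ξ is differentiable at τ and satisfies the characteristic equation ξ′(τ) = c(ξ(τ)). -/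
open Filter Topology MeasureTheory Set

/-- in the Goupillaud medium with time step `Δt`, layer boundaries `x_k`
(strictly increasing, `x₀ = 0`, `x_k → ±∞`), piecewise constant speed
`c(y) = (x_k - x_{k-1})/Δt` for `y ∈ [x_{k-1}, x_k)`, and `ξ` the continuous piecewise
affine function with `ξ(kΔt) = x_k`, affine on each `[(k-1)Δt, kΔt]`, the curve `ξ` is
differentiable at every `τ` not of the form `jΔt` and satisfies the characteristic
equation `ξ'(τ) = c(ξ(τ))` there. -/
theorem stmt14 (Δt : ℝ) (hΔt : 0 < Δt)
    (x : ℤ → ℝ) (hx : StrictMono x) (hx0 : x 0 = 0)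
    (hxtop : Tendsto x atTop atTop) (hxbot : Tendsto x atBot atBot)
    (c : ℝ → ℝ)
    (hc : ∀ k : ℤ, ∀ y ∈ Set.Ico (x (k - 1)) (x k), c y = (x k - x (k - 1)) / Δt)
    (ξ : ℝ → ℝ)
    (hξ : ∀ k : ℤ, ∀ s ∈ Set.Icc (((k : ℝ) - 1) * Δt) ((k : ℝ) * Δt),
      ξ s = x (k - 1) + (s - ((k : ℝ) - 1) * Δt) * (x k - x (k - 1)) / Δt) :
    ∀ τ : ℝ, (∀ j : ℤ, τ ≠ (j : ℝ) * Δt) → HasDerivAt ξ (c (ξ τ)) τ := by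
  intro τ hτ
  set k : ℤ := ⌈τ / Δt⌉
  have hlo : ((k : ℝ) - 1) * Δt < τ := by
    rw [← lt_div_iff₀ hΔt]
    linarith [Int.ceil_lt_add_one (τ / Δt)]
  have hhi : τ < (k : ℝ) * Δt :=
    lt_of_le_of_ne ((div_le_iff₀ hΔt).1 (Int.le_ceil (τ / Δt))) (hτ k)
  have hd : 0 < x k - x (k - 1) := sub_pos.2 (hx (sub_one_lt k))
  have hmem : ξ τ ∈ Set.Ico (x (k - 1)) (x k) := by
    rw [hξ k τ ⟨hlo.le, hhi.le⟩]
    constructor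
    · have := div_nonneg (mul_nonneg (sub_pos.2 hlo).le hd.le) hΔt.le
      linarith
    · have : (τ - ((k : ℝ) - 1) * Δt) * (x k - x (k - 1)) / Δt < x k - x (k - 1) := by
        rw [div_lt_iff₀ hΔt, mul_comm (x k - x (k - 1))]
        exact mul_lt_mul_of_pos_right (by linarith) hd
      linarith
  rw [hc k _ hmem]
  have haff : HasDerivAt
      (fun s ↦ x (k - 1) + (s - ((k : ℝ) - 1) * Δt) * (x k - x (k - 1)) / Δt)
      ((x k - x (k - 1)) / Δt) τ := by
    simpa using ((((hasDerivAt_id τ).sub_const (((k : ℝ) - 1) * Δt)).mul_const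
      (x k - x (k - 1))).div_const Δt).const_add (x (k - 1))
  refine haff.congr_of_eventuallyEq ?_
  filter_upwards [Icc_mem_nhds hlo hhi] with s hs using hξ k s hs
end

section
/- Let Δt > 0, t_j = jΔt, (x_k)_{k∈ℤ} a strictly increasing sequence with x₀ = 0 and x_k → ±∞ as k → ±∞, c(x) = Σ_{k∈ℤ} ((x_k − x_{k−1})/Δt) · 1_{[x_{k−1}, x_k)}(x), and ξ the continuous piecewise affine function with ξ(t_k) = x_k, affine on each [t_{k−1}, t_k]. Let u₀ : ℝ → ℝ be continuously differentiable and define u(t, x) = u₀(ξ(ξ^{-1}(x) − t)). Then u is locally Lipschitz continuous on ℝ², u(0, x) = u₀(x) for all x, and at Lebesgue-almost every point (t, x) ∈ ℝ² both partial derivatives ∂_t u and ∂_x u exist and satisfy the transport equation ∂_t u(t, x) + c(x) ∂_x u(t, x) = 0. -/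
open Filter Topology MeasureTheory Set

/-- Every real lies in one of the half-open cells of a strictly increasing two-sided sequence that
is unbounded in both directions. -/
lemma exists_mem_Ico_of_strictMono {a : ℤ → ℝ} (ha : StrictMono a)
    (htop : Tendsto a atTop atTop) (hbot : Tendsto a atBot atBot) (y : ℝ) :
    ∃ k : ℤ, y ∈ Ico (a (k - 1)) (a k) := by
  obtain ⟨N, hN⟩ := (htop.eventually (eventually_gt_atTop y)).exists
  obtain ⟨M, hM⟩ := (hbot.eventually (eventually_le_atBot y)).exists
  obtain ⟨j, hj, hmax⟩ := Int.exists_greatest_of_bdd (P := fun k => a k ≤ y)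
    ⟨N, fun z hz => (ha.lt_iff_lt.1 (hz.trans_lt hN)).le⟩ ⟨M, hM⟩
  refine ⟨j + 1, by simpa using hj, ?_⟩
  by_contra! h
  have := hmax _ h
  omega

/-- A function that is affine on every cell of a locally finite partition is locally Lipschitz. -/
lemma locallyLipschitz_of_piecewise_affine {a m : ℤ → ℝ} (ha : StrictMono a)
    (htop : Tendsto a atTop atTop) (hbot : Tendsto a atBot atBot) {f : ℝ → ℝ}
    (hf : ∀ k, ∀ y ∈ Icc (a (k - 1)) (a k), ∀ z ∈ Icc (a (k - 1)) (a k),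
      f y - f z = m k * (y - z)) : LocallyLipschitz f := by
  intro y
  obtain ⟨k, hk⟩ := exists_mem_Ico_of_strictMono ha htop hbot y
  set C := max |m (k - 1)| |m k|
  have hC : 0 ≤ C := (abs_nonneg _).trans (le_max_left _ _)
  have hlt : a (k - 1 - 1) < a (k - 1) := ha (by omega)
  have hlt' : a (k - 1) < a k := ha (by omega)
  have left : ∀ p q, p ∈ Icc (a (k - 1 - 1)) (a (k - 1)) → q ∈ Icc (a (k - 1 - 1)) (a (k - 1)) →
      p ≤ q → |f q - f p| ≤ C * (q - p) := by
    intro p q hp hq hpq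
    rw [hf (k - 1) q hq p hp, abs_mul, abs_of_nonneg (sub_nonneg.2 hpq)]
    exact mul_le_mul_of_nonneg_right (le_max_left _ _) (sub_nonneg.2 hpq)
  have right : ∀ p q, p ∈ Icc (a (k - 1)) (a k) → q ∈ Icc (a (k - 1)) (a k) →
      p ≤ q → |f q - f p| ≤ C * (q - p) := by
    intro p q hp hq hpq
    rw [hf k q hq p hp, abs_mul, abs_of_nonneg (sub_nonneg.2 hpq)]
    exact mul_le_mul_of_nonneg_right (le_max_right _ _) (sub_nonneg.2 hpq)
  have key : ∀ p ∈ Ioo (a (k - 1 - 1)) (a k), ∀ q ∈ Ioo (a (k - 1 - 1)) (a k), p ≤ q →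
      |f q - f p| ≤ C * (q - p) := by
    intro p hp q hq hpq
    rcases le_total q (a (k - 1)) with hq' | hq'
    · exact left p q ⟨hp.1.le, hpq.trans hq'⟩ ⟨hq.1.le, hq'⟩ hpq
    rcases le_total p (a (k - 1)) with hp' | hp'
    · have h₁ := left p (a (k - 1)) ⟨hp.1.le, hp'⟩ ⟨hlt.le, le_rfl⟩ hp'
      have h₂ := right (a (k - 1)) q ⟨le_rfl, hlt'.le⟩ ⟨hq', hq.2.le⟩ hq'
      have h₃ := abs_sub_le (f q) (f (a (k - 1))) (f p)
      linarith
    · exact right p q ⟨hp', hp.2.le⟩ ⟨hq', hq.2.le⟩ hpq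
  refine ⟨C.toNNReal, Ioo (a (k - 1 - 1)) (a k),
    Ioo_mem_nhds (hlt.trans_le hk.1) hk.2, LipschitzOnWith.of_dist_le_mul fun p hp q hq => ?_⟩
  rw [Real.coe_toNNReal C hC, Real.dist_eq, Real.dist_eq]
  rcases le_total p q with h | h
  · rw [abs_sub_comm, abs_sub_comm p q, abs_of_nonneg (sub_nonneg.2 h)]
    exact key p hp q hq h
  · rw [abs_of_nonneg (sub_nonneg.2 h)]
    exact key q hq p hp h

lemma hasDerivAt_of_affine_on_Icc {l r m : ℝ} {f : ℝ → ℝ}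
    (hf : ∀ y ∈ Icc l r, ∀ z ∈ Icc l r, f y - f z = m * (y - z)) {y : ℝ} (hy : y ∈ Ioo l r) :
    HasDerivAt f m y := by
  have h : HasDerivAt (fun z => f y + m * (z - y)) m y := by
    simpa using (((hasDerivAt_id y).sub_const y).const_mul m).const_add (f y)
  refine h.congr_of_eventuallyEq ?_
  filter_upwards [Ioo_mem_nhds hy.1 hy.2] with z hz
  linarith [hf z (Ioo_subset_Icc_self hz) y (Ioo_subset_Icc_self hy)]

/-- in the Goupillaud medium with time step `Δt`, layer boundaries `x_k`
(strictly increasing, `x₀ = 0`, `x_k → ±∞`), piecewise constant speed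
`c(y) = (x_k - x_{k-1})/Δt` on `[x_{k-1}, x_k)`, `ξ` the increasing polygon through the
grid points `(kΔt, x_k)` with (two-sided) inverse `ξ⁻¹`, and `u₀` continuously
differentiable, the function `u(t,x) = u₀(ξ(ξ⁻¹(x) - t))` is locally Lipschitz on `ℝ²`,
satisfies `u(0,x) = u₀(x)`, and at Lebesgue-almost every `(t,x)` both partial derivatives
exist and satisfy the transport equation `∂ₜu(t,x) + c(x) ∂ₓu(t,x) = 0`. -/
theorem stmt15 (Δt : ℝ) (hΔt : 0 < Δt)
    (x : ℤ → ℝ) (hx : StrictMono x) (hx0 : x 0 = 0)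
    (hxtop : Tendsto x atTop atTop) (hxbot : Tendsto x atBot atBot)
    (c : ℝ → ℝ)
    (hc : ∀ k : ℤ, ∀ y ∈ Set.Ico (x (k - 1)) (x k), c y = (x k - x (k - 1)) / Δt)
    (ξ : ℝ → ℝ)
    (hξ : ∀ k : ℤ, ∀ s ∈ Set.Icc (((k : ℝ) - 1) * Δt) ((k : ℝ) * Δt),
      ξ s = x (k - 1) + (s - ((k : ℝ) - 1) * Δt) * (x k - x (k - 1)) / Δt)
    (ξinv : ℝ → ℝ)
    (hinv₁ : Function.LeftInverse ξinv ξ) (hinv₂ : Function.RightInverse ξinv ξ)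
    (u₀ : ℝ → ℝ) (hu₀ : ContDiff ℝ 1 u₀)
    (u : ℝ → ℝ → ℝ) (hu : ∀ t y : ℝ, u t y = u₀ (ξ (ξinv y - t))) :
    LocallyLipschitz (fun p : ℝ × ℝ => u p.1 p.2) ∧
      (∀ y : ℝ, u 0 y = u₀ y) ∧
      ∀ᵐ p : ℝ × ℝ ∂(volume : Measure (ℝ × ℝ)),
        ∃ ut ux : ℝ,
          HasDerivAt (fun s => u s p.2) ut p.1 ∧
          HasDerivAt (fun y => u p.1 y) ux p.2 ∧
          ut + c p.2 * ux = 0 := by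
  have hv : ∀ k, 0 < x k - x (k - 1) := fun k => sub_pos.2 (hx (by omega))
  set τ : ℤ → ℝ := fun k => (k : ℝ) * Δt with hτ
  have hτmono : StrictMono τ := fun i j hij =>
    mul_lt_mul_of_pos_right (Int.cast_lt.2 hij) hΔt
  have hτtop : Tendsto τ atTop atTop := tendsto_intCast_atTop_atTop.atTop_mul_const hΔt
  have hτbot : Tendsto τ atBot atBot := by
    have h : Tendsto (fun k : ℤ => (k : ℝ)) atBot atBot := tendsto_intCast_atBot_iff.2 tendsto_id
    exact h.atBot_mul_const hΔt
  have hτpred : ∀ k, τ (k - 1) = ((k : ℝ) - 1) * Δt := fun k => by simp [hτ]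
  have hξaff : ∀ k, ∀ s ∈ Icc (τ (k - 1)) (τ k), ∀ s' ∈ Icc (τ (k - 1)) (τ k),
      ξ s - ξ s' = ((x k - x (k - 1)) / Δt) * (s - s') := by
    intro k s hs s' hs'
    rw [hτpred] at hs hs'
    rw [hξ k s hs, hξ k s' hs']
    ring
  have hinvval : ∀ k, ∀ y ∈ Icc (x (k - 1)) (x k),
      ξinv y = ((k : ℝ) - 1) * Δt + Δt / (x k - x (k - 1)) * (y - x (k - 1)) := by
    intro k y hy
    have hvk := hv k
    have h₀ : 0 ≤ Δt / (x k - x (k - 1)) * (y - x (k - 1)) :=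
      mul_nonneg (div_pos hΔt hvk).le (sub_nonneg.2 hy.1)
    have h₁ : Δt / (x k - x (k - 1)) * (y - x (k - 1)) ≤ Δt := by
      rw [div_mul_eq_mul_div, div_le_iff₀ hvk]
      exact mul_le_mul_of_nonneg_left (by linarith [hy.2]) hΔt.le
    have h := hξ k (((k : ℝ) - 1) * Δt + Δt / (x k - x (k - 1)) * (y - x (k - 1)))
      ⟨by linarith, by linarith⟩
    have h' : ξ (((k : ℝ) - 1) * Δt + Δt / (x k - x (k - 1)) * (y - x (k - 1))) = y := by
      rw [h]
      field_simp
      ring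
    rw [← hinv₁ (((k : ℝ) - 1) * Δt + Δt / (x k - x (k - 1)) * (y - x (k - 1))), h']
  have hinvaff : ∀ k, ∀ y ∈ Icc (x (k - 1)) (x k), ∀ z ∈ Icc (x (k - 1)) (x k),
      ξinv y - ξinv z = (Δt / (x k - x (k - 1))) * (y - z) := by
    intro k y hy z hz
    rw [hinvval k y hy, hinvval k z hz]
    ring
  have hξlip : LocallyLipschitz ξ :=
    locallyLipschitz_of_piecewise_affine (m := fun k => (x k - x (k - 1)) / Δt)
      hτmono hτtop hτbot hξaff
  have hinvlip : LocallyLipschitz ξinv :=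
    locallyLipschitz_of_piecewise_affine (m := fun k => Δt / (x k - x (k - 1)))
      hx hxtop hxbot hinvaff
  refine ⟨?_, fun y => by rw [hu, sub_zero, hinv₂ y], ?_⟩
  · have hsub : LocallyLipschitz (fun p : ℝ × ℝ => ξinv p.2 - p.1) :=
      (contDiff_fst.sub contDiff_snd :
        ContDiff ℝ 1 (fun q : ℝ × ℝ => q.1 - q.2)).locallyLipschitz.comp
        ((hinvlip.comp LipschitzWith.prod_snd.locallyLipschitz).prodMk
          LipschitzWith.prod_fst.locallyLipschitz)
    simp only [hu]
    exact hu₀.locallyLipschitz.comp (hξlip.comp hsub)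
  · have hgood : ∀ᵐ p : ℝ × ℝ ∂(volume : Measure (ℝ × ℝ)),
        ∀ k, p.2 ≠ x k ∧ ξinv p.2 - p.1 ≠ τ k := by
      have hcont := hinvlip.continuous
      rw [Measure.volume_eq_prod, ae_all_iff]
      intro k
      refine (Measure.ae_prod_iff_ae_ae ?_).2 (ae_of_all _ fun t => ?_)
      · exact ((isOpen_ne_fun continuous_snd continuous_const).inter
          (isOpen_ne_fun ((hcont.comp continuous_snd).sub continuous_fst)
            continuous_const)).measurableSet
      · filter_upwards [Measure.ae_ne volume (x k), Measure.ae_ne volume (ξ (t + τ k))]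
          with y hy hy'
        refine ⟨hy, fun h => hy' ?_⟩
        rw [← hinv₂ y, show ξinv y = t + τ k by linarith]
    filter_upwards [hgood] with p hp
    obtain ⟨k, hk⟩ := exists_mem_Ico_of_strictMono hx hxtop hxbot p.2
    obtain ⟨j, hj⟩ := exists_mem_Ico_of_strictMono hτmono hτtop hτbot (ξinv p.2 - p.1)
    have hdinv := hasDerivAt_of_affine_on_Icc (hinvaff k)
      ⟨lt_of_le_of_ne hk.1 (hp (k - 1)).1.symm, hk.2⟩
    have hdξ := hasDerivAt_of_affine_on_Icc (hξaff j)
      ⟨lt_of_le_of_ne hj.1 (hp (j - 1)).2.symm, hj.2⟩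
    have hdu := ((hu₀.differentiable one_ne_zero) (ξ (ξinv p.2 - p.1))).hasDerivAt
    have hduξ := hdu.comp _ hdξ
    simp only [hu]
    have hut := hduξ.comp p.1 ((hasDerivAt_id p.1).const_sub (ξinv p.2))
    have hux := HasDerivAt.comp (h := fun y => ξinv y - p.1) p.2 hduξ (hdinv.sub_const p.1)
    refine ⟨_, _, hut, hux, ?_⟩
    rw [hc k p.2 hk]
    have := (hv k).ne'
    field_simp
    ring
end
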